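/- Let ν > 0 and let V̂ : ℝ² → [0,∞) be bounded and supported in the unit ball. Let q₁, q₂ ∈ ℝ² with q₂ ≠ 0, let θ(q) denote the angle between q and q₂, and let λ, ε > 0. Then ∫_{ℝ²} V̂(q) sin²θ(q) · |q₂| / (|q + q₁| (ε²λ + (ν²/2)|q₂ + q|²)) dq ≤ C, where C depends only on ν and sup V̂ (uniformly in q₁, q₂, λ, ε). -/

import Mathlib

open MeasureTheory

/-- The two-dimensional cross product `u × v = u₁ v₂ − u₂ v₁`. -/
def cross2 (u v : EuclideanSpace ℝ (Fin 2)) : ℝ := u 0 * v 1 - u 1 * v 0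

theorem aux_cross1 (q p : EuclideanSpace ℝ (Fin 2)) :
    (cross2 q p) ^ 2 ≤ ‖q‖ ^ 2 * ‖p + q‖ ^ 2 := by
  simp only [cross2, EuclideanSpace.real_norm_sq_eq, Fin.sum_univ_two, PiLp.add_apply]
  nlinarith [sq_nonneg (q 0 * (p 0 + q 0) + q 1 * (p 1 + q 1))]

theorem aux_cross2 (q p : EuclideanSpace ℝ (Fin 2)) :
    (cross2 q p) ^ 2 ≤ ‖p‖ ^ 2 * ‖p + q‖ ^ 2 := by
  simp only [cross2, EuclideanSpace.real_norm_sq_eq, Fin.sum_univ_two, PiLp.add_apply]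
  nlinarith [sq_nonneg (p 0 * (p 0 + q 0) + p 1 * (p 1 + q 1))]

theorem aux_int : Integrable (fun x : EuclideanSpace ℝ (Fin 2) => 1 / (‖x‖ * (1 + ‖x‖ ^ 2))) := by
  rw [integrable_fun_norm_addHaar (volume : Measure (EuclideanSpace ℝ (Fin 2)))
    (f := fun y : ℝ => 1 / (y * (1 + y ^ 2)))]
  refine (integrable_inv_one_add_sq.integrableOn (s := Set.Ioi 0)).congr_fun ?_ measurableSet_Ioi
  intro y hy
  have hy : 0 < y := hy
  simp
  field_simp

theorem aux_scale (r x : ℝ) (hr : 0 < r) :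
    r / (x * (r ^ 2 + x ^ 2)) = (r ^ 2)⁻¹ * (1 / ((r⁻¹ * x) * (1 + (r⁻¹ * x) ^ 2))) := by
  rcases eq_or_ne x 0 with rfl | hx
  · simp
  have : 0 < r ^ 2 + x ^ 2 := by positivity
  field_simp

theorem aux_int_r (r : ℝ) (hr : 0 < r) :
    Integrable (fun x : EuclideanSpace ℝ (Fin 2) => r / (‖x‖ * (r ^ 2 + ‖x‖ ^ 2))) ∧
    ∫ x : EuclideanSpace ℝ (Fin 2), r / (‖x‖ * (r ^ 2 + ‖x‖ ^ 2)) =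
      ∫ x : EuclideanSpace ℝ (Fin 2), 1 / (‖x‖ * (1 + ‖x‖ ^ 2)) := by
  have e : (fun x : EuclideanSpace ℝ (Fin 2) => r / (‖x‖ * (r ^ 2 + ‖x‖ ^ 2))) =
      fun x => (r ^ 2)⁻¹ * (fun x : EuclideanSpace ℝ (Fin 2) =>
        1 / (‖x‖ * (1 + ‖x‖ ^ 2))) (r⁻¹ • x) := by
    funext x
    simp only [norm_smul, Real.norm_eq_abs, abs_of_pos (inv_pos.2 hr)]
    exact aux_scale r _ hr
  rw [e]
  constructor
  · exact (aux_int.comp_smul (inv_ne_zero hr.ne')).const_mul _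
  · rw [integral_const_mul, Measure.integral_comp_inv_smul volume
      (fun x : EuclideanSpace ℝ (Fin 2) => 1 / (‖x‖ * (1 + ‖x‖ ^ 2))) r]
    simp
    field_simp

theorem aux_ineq (ν M v X a b c r e : ℝ) (hν : 0 < ν) (hv : 0 ≤ v) (hvM : v ≤ M) (hX : 0 ≤ X)
    (ha : 0 ≤ a) (hb : 0 ≤ b) (hc : 0 ≤ c) (hr : 0 < r) (he : 0 < e)
    (h1 : X ≤ a ^ 2 * b ^ 2) (h2 : X ≤ r ^ 2 * b ^ 2) :
    v * (X / (a ^ 2 * r ^ 2)) * r / (c * (e + ν ^ 2 / 2 * b ^ 2)) ≤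
      4 * M / ν ^ 2 * (r / (a * (r ^ 2 + a ^ 2)) + r / (c * (r ^ 2 + c ^ 2))) := by
  have hM : 0 ≤ M := hv.trans hvM
  have hR : 0 ≤ 4 * M / ν ^ 2 * (r / (a * (r ^ 2 + a ^ 2)) + r / (c * (r ^ 2 + c ^ 2))) := by
    positivity
  rcases ha.eq_or_lt with rfl | ha
  · simpa using hR
  rcases hc.eq_or_lt with rfl | hc
  · simpa using hR
  rcases hb.eq_or_lt with rfl | hb
  · have : X = 0 := by nlinarith
    subst this
    simpa using hR
  have s1 : X ≤ 2 * r ^ 2 * (a ^ 2 * b ^ 2) / (r ^ 2 + a ^ 2) := by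
    rw [le_div_iff₀ (by positivity)]
    nlinarith [mul_le_mul_of_nonneg_left h1 (sq_nonneg r),
      mul_le_mul_of_nonneg_left h2 (sq_nonneg a)]
  have s2 : r / (c * (r ^ 2 + a ^ 2)) ≤ r / (a * (r ^ 2 + a ^ 2)) + r / (c * (r ^ 2 + c ^ 2)) := by
    rcases le_total a c with h | h
    · have : r / (c * (r ^ 2 + a ^ 2)) ≤ r / (a * (r ^ 2 + a ^ 2)) := by gcongr
      have : 0 ≤ r / (c * (r ^ 2 + c ^ 2)) := by positivity
      linarith
    · have : r / (c * (r ^ 2 + a ^ 2)) ≤ r / (c * (r ^ 2 + c ^ 2)) := by gcongr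
      have : 0 ≤ r / (a * (r ^ 2 + a ^ 2)) := by positivity
      linarith
  calc v * (X / (a ^ 2 * r ^ 2)) * r / (c * (e + ν ^ 2 / 2 * b ^ 2))
      ≤ M * ((2 * r ^ 2 * (a ^ 2 * b ^ 2) / (r ^ 2 + a ^ 2)) / (a ^ 2 * r ^ 2)) * r /
        (c * (ν ^ 2 / 2 * b ^ 2)) := by
        gcongr
        linarith
    _ = 4 * M / ν ^ 2 * (r / (c * (r ^ 2 + a ^ 2))) := by
        field_simp
        norm_num
    _ ≤ _ := by gcongr

theorem stmt9 (ν M : ℝ) (hν : 0 < ν) (hM : 0 ≤ M) :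
    ∃ C : ℝ, 0 < C ∧ ∀ V : EuclideanSpace ℝ (Fin 2) → ℝ, Measurable V →
      (∀ q, 0 ≤ V q) → (∀ q, V q ≤ M) → (∀ q, 1 < ‖q‖ → V q = 0) →
      ∀ q₁ q₂ : EuclideanSpace ℝ (Fin 2), q₂ ≠ 0 →
      ∀ lam ε : ℝ, 0 < lam → 0 < ε →
        (∫ q : EuclideanSpace ℝ (Fin 2),
            V q * ((cross2 q q₂) ^ 2 / (‖q‖ ^ 2 * ‖q₂‖ ^ 2)) * ‖q₂‖ /
              (‖q + q₁‖ * (ε ^ 2 * lam + ν ^ 2 / 2 * ‖q₂ + q‖ ^ 2)))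
          ≤ C := by
  set I := ∫ x : EuclideanSpace ℝ (Fin 2), 1 / (‖x‖ * (1 + ‖x‖ ^ 2)) with hI
  have hI0 : 0 ≤ I := integral_nonneg fun x => by positivity
  refine ⟨4 * M / ν ^ 2 * (I + I) + 1, by positivity, ?_⟩
  intro V _ hV0 hVM _ q₁ q₂ hq lam ε hl he
  have hr : 0 < ‖q₂‖ := norm_pos_iff.2 hq
  obtain ⟨i1, i2⟩ := aux_int_r ‖q₂‖ hr
  have i3 := i1.comp_add_right q₁
  have i4 := integral_add_right_eq_self (μ := (volume : Measure (EuclideanSpace ℝ (Fin 2))))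
    (fun x : EuclideanSpace ℝ (Fin 2) => ‖q₂‖ / (‖x‖ * (‖q₂‖ ^ 2 + ‖x‖ ^ 2))) q₁
  have key := integral_mono_of_nonneg (μ := (volume : Measure (EuclideanSpace ℝ (Fin 2))))
    (f := fun q => V q * ((cross2 q q₂) ^ 2 / (‖q‖ ^ 2 * ‖q₂‖ ^ 2)) * ‖q₂‖ /
              (‖q + q₁‖ * (ε ^ 2 * lam + ν ^ 2 / 2 * ‖q₂ + q‖ ^ 2)))
    (Filter.Eventually.of_forall fun q => by
      have := hV0 q
      simp only [Pi.zero_apply]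
      positivity)
    ((i1.add i3).const_mul (4 * M / ν ^ 2))
    (Filter.Eventually.of_forall fun q =>
      aux_ineq ν M (V q) _ ‖q‖ ‖q₂ + q‖ ‖q + q₁‖ ‖q₂‖ (ε ^ 2 * lam) hν (hV0 q) (hVM q)
        (sq_nonneg _) (norm_nonneg _) (norm_nonneg _) (norm_nonneg _) hr (by positivity)
        (aux_cross1 q q₂) (aux_cross2 q q₂))
  rw [integral_const_mul, integral_add' i1 i3, i4, i2] at key
  linarith
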